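/- Let p be an odd prime, let G = DihedralGroup p, and let ℤ₋ be the G-representation on ℤ in which every rotation r i acts by +1 and every reflection sr i acts by −1. For every n ≥ 1, the group cohomology H^n(G; ℤ₋) is: isomorphic to ZMod 2 if n is odd; isomorphic to ZMod p if n ≡ 2 mod 4; and the zero module if n ≡ 0 mod 4. -/

import Mathlib

/-- The representation of the dihedral group on `ℤ` where every rotation `r i`
acts by `+1` and every reflection `sr i` acts by `−1`. -/
def zminusRep (p : ℕ) : Representation ℤ (DihedralGroup p) ℤ where
  toFun g := match g with
    | .r _ => 1
    | .sr _ => -1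
  map_one' := rfl
  map_mul' := by
    rintro (i | i) (j | j) <;>
      simp [DihedralGroup.r_mul_r, DihedralGroup.r_mul_sr,
        DihedralGroup.sr_mul_r, DihedralGroup.sr_mul_sr]

/-- The sign-twisted coefficients `ℤ₋` as a `Rep ℤ (DihedralGroup p)`. -/
noncomputable def zminus (p : ℕ) : Rep ℤ (DihedralGroup p) := Rep.of (zminusRep p)

namespace DihedralSign

open CategoryTheory

/-- The one-dimensional representation of `DihedralGroup p` on `ℤ` in which rotations act trivially
and reflections act by the unit `ε`. -/
def signRep (p : ℕ) (ε : ℤˣ) : Representation ℤ (DihedralGroup p) ℤ where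
  toFun g := match g with
    | .r _ => 1
    | .sr _ => ((ε : ℤ) • 1 : ℤ →ₗ[ℤ] ℤ)
  map_one' := rfl
  map_mul' := by
    rintro (i | i) (j | j) <;> ext <;> simp [← Units.val_mul]

/-- The representation of `DihedralGroup p` on functions `ZMod p → ℤ` induced from the character `ε`
of the subgroup generated by the reflection `sr 0`. -/
def funRep (p : ℕ) (ε : ℤˣ) : Representation ℤ (DihedralGroup p) (ZMod p → ℤ) where
  toFun g := match g with
    | .r j => LinearMap.funLeft ℤ ℤ (fun i => i + j)
    | .sr j => (ε : ℤ) • LinearMap.funLeft ℤ ℤ (fun i => j - i)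
  map_one' := by
    rw [DihedralGroup.one_def]
    ext; simp [LinearMap.funLeft]
  map_mul' := by
    rintro (i | i) (j | j) <;> refine LinearMap.ext fun f => funext fun k => ?_ <;>
      simp [LinearMap.funLeft, ← mul_assoc, ← Units.val_mul]
    all_goals (congr 1; ring)

/-- The representation of `DihedralGroup p` on `ℤ × ℤ` in which rotations act trivially and
reflections swap the coordinates. -/
def swapRep (p : ℕ) : Representation ℤ (DihedralGroup p) (ℤ × ℤ) where
  toFun g := match g with
    | .r _ => 1
    | .sr _ => (LinearEquiv.prodComm ℤ ℤ ℤ).toLinearMap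
  map_one' := rfl
  map_mul' := by
    rintro (i | i) (j | j) <;> refine LinearMap.ext fun x => ?_ <;> simp

variable {p : ℕ} {ε : ℤˣ}

@[simp] lemma signRep_r (i : ZMod p) (x : ℤ) : signRep p ε (.r i) x = x := rfl
@[simp] lemma signRep_sr (i : ZMod p) (x : ℤ) : signRep p ε (.sr i) x = ε * x := rfl
@[simp] lemma funRep_r (j : ZMod p) (f : ZMod p → ℤ) (i : ZMod p) :
    funRep p ε (.r j) f i = f (i + j) := rfl
@[simp] lemma funRep_sr (j : ZMod p) (f : ZMod p → ℤ) (i : ZMod p) :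
    funRep p ε (.sr j) f i = ε * f (j - i) := rfl
@[simp] lemma swapRep_r (i : ZMod p) (x : ℤ × ℤ) : swapRep p (.r i) x = x := rfl
@[simp] lemma swapRep_sr (i : ZMod p) (x : ℤ × ℤ) : swapRep p (.sr i) x = x.swap := rfl

lemma signRep_neg_one : signRep p (-1) = zminusRep p := by
  ext g
  rcases g with i | i <;> rfl

lemma exists_r_of_mem_zpowers {g : DihedralGroup p}
    (hg : g ∈ Subgroup.zpowers (DihedralGroup.r (1 : ZMod p))) : ∃ i, g = .r i := by
  obtain ⟨k, rfl⟩ := hg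
  exact ⟨k, by simp⟩

lemma eq_one_or_sr_of_mem_zpowers {g : DihedralGroup p}
    (hg : g ∈ Subgroup.zpowers (DihedralGroup.sr (0 : ZMod p))) : g = 1 ∨ g = .sr 0 := by
  obtain ⟨k, rfl⟩ := hg
  obtain ⟨m, rfl | rfl⟩ := Int.even_or_odd' k
  · left; simp only [zpow_mul, zpow_ofNat, sq]; simp
  · right; simp only [zpow_add, zpow_mul, zpow_ofNat, sq]; simp

/-- Coinducing the character `ε` from the subgroup generated by `sr 0` gives `funRep`. -/
def coindReflectionEquiv (p : ℕ) (ε : ℤˣ) :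
    (Representation.coind (Subgroup.zpowers (DihedralGroup.sr (0 : ZMod p))).subtype
      ((signRep p ε).comp (Subgroup.subtype _))).Equiv (funRep p ε) :=
  .mk (LinearEquiv.ofLinearMap
    { toFun f i := f.1 (.r i), map_add' := fun _ _ => rfl, map_smul' := fun _ _ => rfl }
    { toFun f := ⟨fun g => match g with
        | .r i => f i
        | .sr i => ε * f i, by
          rintro ⟨s, hs⟩ g
          rcases eq_one_or_sr_of_mem_zpowers hs with rfl | rfl
          · simp only [Subgroup.subtype_apply, one_mul, MonoidHom.coe_comp, Function.comp_apply,
              map_one, Module.End.one_apply]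
          · rcases g with i | i <;> simp [← mul_assoc, ← Units.val_mul]⟩
      map_add' f g := by ext (i | i) <;> simp [mul_add]
      map_smul' f g := by ext (i | i) <;> simp [mul_left_comm] }
    (by ext; simp)
    (by
      refine LinearMap.ext fun f => Subtype.ext (funext fun g => ?_)
      rcases g with i | i
      · simp
      · simpa using (f.2 ⟨.sr 0, Subgroup.mem_zpowers _⟩ (.r i)).symm))
  (by
    rintro (j | j) <;> refine LinearMap.ext fun f => funext fun i => ?_
    · change f.1 (.r i * .r j) = f.1 (.r (i + j))
      simp
    · change f.1 (.r i * .sr j) = ε * f.1 (.r (j - i))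
      simpa using (f.2 ⟨.sr 0, Subgroup.mem_zpowers _⟩ (.r (j - i))))

/-- Coinducing the trivial character from the rotation subgroup gives `swapRep`. -/
def coindRotationEquiv (p : ℕ) :
    (Representation.coind (Subgroup.zpowers (DihedralGroup.r (1 : ZMod p))).subtype
      ((signRep p 1).comp (Subgroup.subtype _))).Equiv (swapRep p) :=
  have key (f : Representation.coindV (Subgroup.zpowers (DihedralGroup.r (1 : ZMod p))).subtype
      ((signRep p 1).comp (Subgroup.subtype _))) (i : ZMod p) (g : DihedralGroup p) :
      f.1 (.r i * g) = f.1 g := by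
    have hi : DihedralGroup.r i ∈ Subgroup.zpowers (DihedralGroup.r (1 : ZMod p)) :=
      ⟨i.cast, by simp⟩
    simpa using f.2 ⟨_, hi⟩ g
  .mk (LinearEquiv.ofLinearMap
    { toFun f := (f.1 1, f.1 (.sr 0)), map_add' := fun _ _ => rfl, map_smul' := fun _ _ => rfl }
    { toFun x := ⟨fun g => match g with
        | .r _ => x.1
        | .sr _ => x.2, by
          rintro ⟨s, hs⟩ g
          obtain ⟨i, rfl⟩ := exists_r_of_mem_zpowers hs
          rcases g with j | j <;> simp⟩
      map_add' f g := by ext (i | i) <;> simp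
      map_smul' f g := by ext (i | i) <;> simp }
    (by ext <;> rfl)
    (by
      refine LinearMap.ext fun f => Subtype.ext (funext fun g => ?_)
      rcases g with i | i
      · simpa using (key f i 1).symm
      · simpa using (key f (-i) (.sr 0)).symm))
  (by
    rintro (j | j) <;> refine LinearMap.ext fun f => ?_
    · refine Prod.ext ?_ ?_
      · change f.1 (1 * .r j) = f.1 1
        simpa using key f j 1
      · change f.1 (.sr 0 * .r j) = f.1 (.sr 0)
        simpa using key f (-j) (.sr 0)
    · refine Prod.ext ?_ ?_
      · change f.1 (1 * .sr j) = f.1 (.sr 0)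
        simpa using key f (-j) (.sr 0)
      · change f.1 (.sr 0 * .sr j) = f.1 1
        simpa using key f j 1)

/-- A quotient of `ℤ` with kernel `m ℤ` is `ZMod m`. -/
lemma nonempty_equiv_zmod {H : Type*} [AddCommGroup H] [Module ℤ H] {m : ℕ} (f : ℤ →ₗ[ℤ] H)
    (hf : Function.Surjective f) (h : ∀ x, f x = 0 ↔ (m : ℤ) ∣ x) :
    Nonempty (H ≃ₗ[ℤ] ZMod m) := by
  have hker : LinearMap.ker f = Ideal.span {(m : ℤ)} := by
    ext x
    rw [LinearMap.mem_ker, h, Ideal.mem_span_singleton]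
  exact ⟨(f.quotKerEquivOfSurjective hf).symm ≪≫ₗ Submodule.quotEquivOfEq _ _ hker ≪≫ₗ
    (Int.quotientSpanNatEquivZMod m).toAddEquiv.toIntLinearEquiv⟩

section Cyclic

open Rep.FiniteCyclicGroup

variable {k S V : Type} [CommRing k] [Group S] [Fintype S] [AddCommGroup V] [Module k V]
  (σ : Representation k S V) {g : S}
  (hg : ∀ x, x ∈ Subgroup.zpowers g) {n : ℕ}

include hg

lemma exists_cyclic_odd (hn : Odd n) :
    ∃ π : LinearMap.ker σ.norm →ₗ[k] groupCohomology (Rep.of σ) n,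
      Function.Surjective π ∧ ∀ x, π x = 0 ↔ ∃ y, σ g y - y = x := by
  have : IsCyclic S := ⟨g, hg⟩
  let : CommGroup S := IsCyclic.commGroup
  refine ⟨(groupCohomologyπOdd (Rep.of σ) g hg n hn).hom, ?_, fun x => ?_⟩
  · exact (ModuleCat.epi_iff_surjective _).1
      (epi_comp' (@IsIso.epi_of_iso _ _ _ _ _ (Iso.isIso_inv _))
        (epi_comp' inferInstance inferInstance))
  · exact groupCohomologyπOdd_eq_zero_iff (Rep.of σ) g hg n hn x

lemma exists_cyclic_even (hn : Even n) (hn0 : n ≠ 0) :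
    ∃ π : LinearMap.ker (σ g - 1) →ₗ[k] groupCohomology (Rep.of σ) n,
      Function.Surjective π ∧ ∀ x, π x = 0 ↔ ∃ y, σ.norm y = x := by
  have : NeZero n := ⟨hn0⟩
  have : IsCyclic S := ⟨g, hg⟩
  let : CommGroup S := IsCyclic.commGroup
  refine ⟨(groupCohomologyπEven (Rep.of σ) g hg n hn).hom, ?_, fun x => ?_⟩
  · exact (ModuleCat.epi_iff_surjective _).1
      (epi_comp' (@IsIso.epi_of_iso _ _ _ _ _ (Iso.isIso_inv _))
        (epi_comp' inferInstance inferInstance))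
  · exact groupCohomologyπEven_eq_zero_iff (Rep.of σ) g hg n hn x

lemma subsingleton_cyclic_odd (hσ : ∀ x, σ.norm x = 0 → x = 0) (hn : Odd n) :
    Subsingleton (groupCohomology (Rep.of σ) n) := by
  obtain ⟨π, hπ, -⟩ := exists_cyclic_odd σ hg hn
  have : Subsingleton (LinearMap.ker σ.norm) :=
    ⟨fun x y => Subtype.ext ((hσ _ x.2).trans (hσ _ y.2).symm)⟩
  exact hπ.subsingleton

lemma subsingleton_cyclic_even (hσ : ∀ x, σ g x = x → x = 0) (hn : Even n) (hn0 : n ≠ 0) :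
    Subsingleton (groupCohomology (Rep.of σ) n) := by
  obtain ⟨π, hπ, -⟩ := exists_cyclic_even σ hg hn hn0
  have hker (x : V) (hx : x ∈ LinearMap.ker (σ g - (1 : Module.End k V))) : x = 0 :=
    hσ _ (sub_eq_zero.1 hx)
  have : Subsingleton (LinearMap.ker (σ g - (1 : Module.End k V))) :=
    ⟨fun x y => Subtype.ext ((hker _ x.2).trans (hker _ y.2).symm)⟩
  exact hπ.subsingleton

lemma nonempty_equiv_cyclic_odd (σ : Representation ℤ S ℤ) {m : ℕ} (hσ : ∀ x, σ.norm x = 0)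
    (hm : ∀ x, σ g x - x = -(m * x)) (hn : Odd n) :
    Nonempty (groupCohomology (Rep.of σ) n ≃ₗ[ℤ] ZMod m) := by
  obtain ⟨π, hπ, hπ0⟩ := exists_cyclic_odd σ hg hn
  refine nonempty_equiv_zmod (π ∘ₗ LinearMap.codRestrict (LinearMap.ker σ.norm) LinearMap.id hσ)
    (hπ.comp fun x => ⟨x.1, rfl⟩) fun x => ?_
  refine (hπ0 _).trans ⟨fun ⟨y, hy⟩ => ⟨-y, ?_⟩, fun ⟨y, hy⟩ => ⟨-y, ?_⟩⟩
  · change _ = x at hy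
    rw [← hy, hm, mul_neg]
  · change _ = x
    rw [hm, hy, mul_neg, neg_neg]

lemma nonempty_equiv_cyclic_even (σ : Representation ℤ S ℤ) {m : ℕ} (hσ : ∀ x, σ.norm x = m * x)
    (h1 : ∀ x, σ g x = x) (hn : Even n) (hn0 : n ≠ 0) :
    Nonempty (groupCohomology (Rep.of σ) n ≃ₗ[ℤ] ZMod m) := by
  obtain ⟨π, hπ, hπ0⟩ := exists_cyclic_even σ hg hn hn0
  refine nonempty_equiv_zmod
    (π ∘ₗ LinearMap.codRestrict (LinearMap.ker (σ g - 1)) LinearMap.id fun x => by simp [h1])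
    (hπ.comp fun x => ⟨x.1, rfl⟩) fun x => ?_
  refine (hπ0 _).trans ⟨fun ⟨y, hy⟩ => ⟨y, ?_⟩, fun ⟨y, hy⟩ => ⟨y, ?_⟩⟩
  · exact hy.symm.trans (hσ y)
  · exact (hσ y).trans hy.symm

end Cyclic

/-- Shapiro's lemma for a representation equivalent to a coinduced one. -/
lemma nonempty_shapiro {G V W : Type} [Group G] [AddCommGroup V] [AddCommGroup W]
    (S : Subgroup G) (σ : Representation ℤ S V) (τ : Representation ℤ G W)
    (e : (Representation.coind S.subtype σ).Equiv τ) (n : ℕ) :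
    Nonempty (groupCohomology (Rep.of τ) n ≃ₗ[ℤ] groupCohomology (Rep.of σ) n) :=
  ⟨(((groupCohomology.functor ℤ G n).mapIso (Rep.mkIso e)).symm ≪≫
    groupCohomology.coindIso (Rep.of σ) n).toLinearEquiv⟩

lemma mem_zpowers_mk {G : Type*} [Group G] (g : G) (x : Subgroup.zpowers g) :
    x ∈ Subgroup.zpowers (⟨g, Subgroup.mem_zpowers g⟩ : Subgroup.zpowers g) := by
  obtain ⟨_, k, rfl⟩ := x
  exact ⟨k, rfl⟩

section Induced

variable {n : ℕ}

lemma nonempty_swapRep_equiv (p : ℕ) (n : ℕ) :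
    Nonempty (groupCohomology (Rep.of (swapRep p)) n ≃ₗ[ℤ] groupCohomology (Rep.of
      ((signRep p 1).comp (Subgroup.zpowers (DihedralGroup.r (1 : ZMod p))).subtype)) n) :=
  nonempty_shapiro _ _ _ (coindRotationEquiv p) n

lemma nonempty_funRep_equiv (p : ℕ) (ε : ℤˣ) (n : ℕ) :
    Nonempty (groupCohomology (Rep.of (funRep p ε)) n ≃ₗ[ℤ] groupCohomology (Rep.of
      ((signRep p ε).comp (Subgroup.zpowers (DihedralGroup.sr (0 : ZMod p))).subtype)) n) :=
  nonempty_shapiro _ _ _ (coindReflectionEquiv p ε) n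

lemma signRep_of_mem_rotation (x : Subgroup.zpowers (DihedralGroup.r (1 : ZMod p))) (z : ℤ) :
    (signRep p ε).comp (Subgroup.subtype _) x z = z := by
  obtain ⟨i, hi⟩ := exists_r_of_mem_zpowers x.2
  simp [hi]

lemma norm_rotation [Fintype (Subgroup.zpowers (DihedralGroup.r (1 : ZMod p)))] (x : ℤ) :
    Representation.norm ((signRep p ε).comp
      (Subgroup.zpowers (DihedralGroup.r (1 : ZMod p))).subtype) x = p * x := by
  have hc : Fintype.card (Subgroup.zpowers (DihedralGroup.r (1 : ZMod p))) = p := by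
    rw [← Nat.card_eq_fintype_card, Nat.card_zpowers, DihedralGroup.orderOf_r_one]
  simp only [Representation.norm, LinearMap.sum_apply, signRep_of_mem_rotation, Finset.sum_const,
    Finset.card_univ, hc, nsmul_eq_mul]

lemma norm_reflection [Fintype (Subgroup.zpowers (DihedralGroup.sr (0 : ZMod p)))] (x : ℤ) :
    Representation.norm ((signRep p ε).comp
      (Subgroup.zpowers (DihedralGroup.sr (0 : ZMod p))).subtype) x = (1 + ε) * x := by
  have hu : (Finset.univ : Finset (Subgroup.zpowers (DihedralGroup.sr (0 : ZMod p)))) =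
      {1, ⟨.sr 0, Subgroup.mem_zpowers _⟩} := by
    ext ⟨g, hg⟩
    simpa [Subtype.ext_iff] using eq_one_or_sr_of_mem_zpowers hg
  have hne : (1 : Subgroup.zpowers (DihedralGroup.sr (0 : ZMod p))) ≠
      ⟨.sr 0, Subgroup.mem_zpowers _⟩ := by
    simp only [ne_eq, Subtype.ext_iff, Subgroup.coe_one, DihedralGroup.one_def]
    exact nofun
  rw [Representation.norm, LinearMap.sum_apply, hu, Finset.sum_pair hne, map_one]
  simp [add_mul]

lemma nonempty_swapRep_equiv_zmod [NeZero p] (hn : Even n) (hn0 : n ≠ 0) :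
    Nonempty (groupCohomology (Rep.of (swapRep p)) n ≃ₗ[ℤ] ZMod p) := by
  let : Fintype (Subgroup.zpowers (DihedralGroup.r (1 : ZMod p))) := Fintype.ofFinite _
  obtain ⟨e⟩ := nonempty_swapRep_equiv p n
  obtain ⟨e'⟩ := nonempty_equiv_cyclic_even (mem_zpowers_mk _) _ (m := p)
    (norm_rotation (p := p) (ε := 1)) (signRep_of_mem_rotation _) hn hn0
  exact ⟨e ≪≫ₗ e'⟩

lemma subsingleton_swapRep [NeZero p] (hn : Odd n) :
    Subsingleton (groupCohomology (Rep.of (swapRep p)) n) := by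
  let : Fintype (Subgroup.zpowers (DihedralGroup.r (1 : ZMod p))) := Fintype.ofFinite _
  obtain ⟨e⟩ := nonempty_swapRep_equiv p n
  have := subsingleton_cyclic_odd ((signRep p 1).comp (Subgroup.subtype _))
    (mem_zpowers_mk (DihedralGroup.r (1 : ZMod p)))
    (fun x hx => by simpa [norm_rotation, NeZero.ne p] using hx) hn
  exact e.toEquiv.subsingleton

lemma subsingleton_funRep_one [NeZero p] (hn : Odd n) :
    Subsingleton (groupCohomology (Rep.of (funRep p 1)) n) := by
  let : Fintype (Subgroup.zpowers (DihedralGroup.sr (0 : ZMod p))) := Fintype.ofFinite _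
  obtain ⟨e⟩ := nonempty_funRep_equiv p 1 n
  have := subsingleton_cyclic_odd ((signRep p 1).comp (Subgroup.subtype _))
    (mem_zpowers_mk (DihedralGroup.sr (0 : ZMod p)))
    (fun x hx => by simpa [norm_reflection] using hx) hn
  exact e.toEquiv.subsingleton

lemma nonempty_funRep_one_equiv_zmod [NeZero p] (hn : Even n) (hn0 : n ≠ 0) :
    Nonempty (groupCohomology (Rep.of (funRep p 1)) n ≃ₗ[ℤ] ZMod 2) := by
  let : Fintype (Subgroup.zpowers (DihedralGroup.sr (0 : ZMod p))) := Fintype.ofFinite _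
  obtain ⟨e⟩ := nonempty_funRep_equiv p 1 n
  obtain ⟨e'⟩ := nonempty_equiv_cyclic_even
    (mem_zpowers_mk (DihedralGroup.sr (0 : ZMod p))) ((signRep p 1).comp (Subgroup.subtype _))
    (m := 2) (fun x => by rw [norm_reflection]; norm_num) (fun x => by simp) hn hn0
  exact ⟨e ≪≫ₗ e'⟩

lemma subsingleton_funRep_neg_one [NeZero p] (hn : Even n) (hn0 : n ≠ 0) :
    Subsingleton (groupCohomology (Rep.of (funRep p (-1))) n) := by
  let : Fintype (Subgroup.zpowers (DihedralGroup.sr (0 : ZMod p))) := Fintype.ofFinite _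
  obtain ⟨e⟩ := nonempty_funRep_equiv p (-1) n
  have := subsingleton_cyclic_even ((signRep p (-1)).comp (Subgroup.subtype _))
    (mem_zpowers_mk (DihedralGroup.sr (0 : ZMod p)))
    (fun x hx => by
      have : -x = x := by simpa using hx
      lia) hn hn0
  exact e.toEquiv.subsingleton

lemma nonempty_funRep_neg_one_equiv_zmod [NeZero p] (hn : Odd n) :
    Nonempty (groupCohomology (Rep.of (funRep p (-1))) n ≃ₗ[ℤ] ZMod 2) := by
  let : Fintype (Subgroup.zpowers (DihedralGroup.sr (0 : ZMod p))) := Fintype.ofFinite _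
  obtain ⟨e⟩ := nonempty_funRep_equiv p (-1) n
  obtain ⟨e'⟩ := nonempty_equiv_cyclic_odd
    (mem_zpowers_mk (DihedralGroup.sr (0 : ZMod p))) ((signRep p (-1)).comp (Subgroup.subtype _))
    (m := 2) (fun x => by rw [norm_reflection]; simp) (fun x => by simp; ring) hn
  exact ⟨e ≪≫ₗ e'⟩

end Induced

section LongExactSequence

variable {k G V W U : Type} [CommRing k] [Group G] [AddCommGroup V] [AddCommGroup W]
  [AddCommGroup U] [Module k V] [Module k W] [Module k U] {ρ : Representation k G V}
  {σ : Representation k G W} {τ : Representation k G U}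

/-- The map on group cohomology induced by an intertwining map. -/
noncomputable def cohomologyMap (f : ρ.IntertwiningMap σ) (n : ℕ) :
    groupCohomology (Rep.of ρ) n →ₗ[k] groupCohomology (Rep.of σ) n :=
  ((groupCohomology.functor k G n).map (Rep.ofHom f)).hom

lemma shortExact_of_exact (f : ρ.IntertwiningMap σ) (g : σ.IntertwiningMap τ)
    (hf : Function.Injective f) (hg : Function.Surjective g) (hfg : Function.Exact f g) :
    (ShortComplex.mk (Rep.ofHom f) (Rep.ofHom g)
      (by ext x; exact hfg.apply_apply_eq_zero x)).ShortExact where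
  exact := by
    rw [← ShortComplex.exact_map_iff_of_faithful _ (forget₂ (Rep k G) (ModuleCat k))]
    exact (ShortComplex.ShortExact.moduleCat_exact_iff_function_exact _).2 hfg
  mono_f := (Rep.mono_iff_injective _).2 hf
  epi_g := (Rep.epi_iff_surjective _).2 hg

lemma exists_connecting (f : ρ.IntertwiningMap σ) (g : σ.IntertwiningMap τ)
    (hf : Function.Injective f) (hg : Function.Surjective g) (hfg : Function.Exact f g) :
    ∃ δ : ∀ n, groupCohomology (Rep.of τ) n →ₗ[k] groupCohomology (Rep.of ρ) (n + 1),
      ∀ n, Function.Exact (cohomologyMap f n) (cohomologyMap g n) ∧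
        Function.Exact (cohomologyMap g n) (δ n) ∧
        Function.Exact (δ n) (cohomologyMap f (n + 1)) := by
  have hX := shortExact_of_exact f g hf hg hfg
  refine ⟨fun n => (groupCohomology.δ hX n (n + 1) rfl).hom, fun n => ⟨?_, ?_, ?_⟩⟩
  · exact (ShortComplex.ShortExact.moduleCat_exact_iff_function_exact _).1
      (groupCohomology.mapShortComplex₂_exact hX n)
  · exact (ShortComplex.ShortExact.moduleCat_exact_iff_function_exact _).1
      (groupCohomology.mapShortComplex₃_exact hX rfl)
  · exact (ShortComplex.ShortExact.moduleCat_exact_iff_function_exact _).1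
      (groupCohomology.mapShortComplex₁_exact hX rfl)

lemma cohomologyMap_comp_eq_nsmul (f : ρ.IntertwiningMap σ) (g : σ.IntertwiningMap ρ) (m : ℕ)
    (h : ∀ x, g (f x) = m • x) (n : ℕ) (x : groupCohomology (Rep.of ρ) n) :
    cohomologyMap g n (cohomologyMap f n x) = m • x := by
  have hc : Rep.ofHom f ≫ Rep.ofHom g = m • 𝟙 (Rep.of ρ) := by
    ext x; exact h x
  have : (groupCohomology.functor k G n).Additive :=
    inferInstanceAs (groupCohomology.cochainsFunctor k G ⋙
      HomologicalComplex.homologyFunctor (ModuleCat k) (ComplexShape.up ℕ) n).Additive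
  have h2 := congr_arg (groupCohomology.functor k G n).map hc
  rw [Functor.map_comp, Functor.map_nsmul, CategoryTheory.Functor.map_id] at h2
  exact congr_arg (fun φ => φ.hom x) h2

lemma exists_invariants_lift (f : ρ.IntertwiningMap σ)
    (h : Function.Surjective (cohomologyMap f 0)) (y : W) (hy : ∀ g, σ g y = y) :
    ∃ x, (∀ g, ρ g x = x) ∧ f x = y := by
  obtain ⟨z, hz⟩ := h ((groupCohomology.H0Iso (Rep.of σ)).inv.hom ⟨y, hy⟩)
  have key := congr_arg (fun φ => φ.hom z) (groupCohomology.map_id_comp_H0Iso_hom (Rep.ofHom f))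
  have hz' : (groupCohomology.H0Iso (Rep.of σ)).hom.hom (cohomologyMap f 0 z) = ⟨y, hy⟩ := by
    rw [hz]
    exact congr_arg (fun φ => φ.hom ⟨y, hy⟩) (groupCohomology.H0Iso (Rep.of σ)).inv_hom_id
  exact ⟨_, ((groupCohomology.H0Iso (Rep.of ρ)).hom.hom z).2,
    congr_arg Subtype.val (key.symm.trans hz')⟩

lemma subsingleton_zero (h : ∀ y, (∀ g, σ g y = y) → y = 0) :
    Subsingleton (groupCohomology (Rep.of σ) 0) := by
  have : Subsingleton σ.invariants :=
    ⟨fun x y => Subtype.ext ((h _ x.2).trans (h _ y.2).symm)⟩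
  exact (groupCohomology.H0Iso (Rep.of σ)).toLinearEquiv.toEquiv.subsingleton

section FourTerm

variable {V₀ V₁ V₂ V₃ : Type} [AddCommGroup V₀] [AddCommGroup V₁] [AddCommGroup V₂]
  [AddCommGroup V₃] [Module k V₀] [Module k V₁] [Module k V₂] [Module k V₃]
  {ρ₀ : Representation k G V₀} {ρ₁ : Representation k G V₁} {ρ₂ : Representation k G V₂}
  {ρ₃ : Representation k G V₃} (f : ρ₀.IntertwiningMap ρ₁) (d : ρ₁.IntertwiningMap ρ₂)
  (s : ρ₂.IntertwiningMap ρ₃)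

include d s in
/-- An exact sequence `0 ⟶ ρ₀ ⟶ ρ₁ ⟶ ρ₂ ⟶ ρ₃ ⟶ 0` splits into two short exact sequences through a
module `M`. -/
lemma exists_connecting_fourTerm (hf : Function.Injective f) (hs : Function.Surjective s)
    (hfd : Function.Exact f d) (hds : Function.Exact d s) (n : ℕ) :
    ∃ (M : ModuleCat.{0} k) (δ : groupCohomology (Rep.of ρ₃) n →ₗ[k] M)
      (i : M →ₗ[k] groupCohomology (Rep.of ρ₂) (n + 1))
      (q : groupCohomology (Rep.of ρ₁) (n + 1) →ₗ[k] M)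
      (δ' : M →ₗ[k] groupCohomology (Rep.of ρ₀) (n + 2)),
      Function.Exact (cohomologyMap s n) δ ∧ Function.Exact δ i ∧ Function.Exact q δ' ∧
        Function.Exact δ' (cohomologyMap f (n + 2)) := by
  let i : s.ker.toRepresentation.IntertwiningMap ρ₂ :=
    ⟨s.ker.toSubmodule.subtype, fun _ => rfl⟩
  let q : ρ₁.IntertwiningMap s.ker.toRepresentation :=
    ⟨d.toLinearMap.codRestrict s.ker.toSubmodule hds.apply_apply_eq_zero, fun g => by
      ext x; exact LinearMap.congr_fun (d.isIntertwining' g) x⟩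
  obtain ⟨δ, hδ⟩ := exists_connecting i s Subtype.val_injective hs
    (fun x => by exact ⟨fun hx => ⟨⟨x, hx⟩, rfl⟩, by rintro ⟨y, rfl⟩; exact y.2⟩)
  obtain ⟨δ', hδ'⟩ := exists_connecting f q hf
    (by
      rintro ⟨y, hy⟩
      obtain ⟨x, rfl⟩ := (hds y).1 hy
      exact ⟨x, rfl⟩)
    (fun x => by exact Subtype.ext_iff.trans (hfd x))
  exact ⟨groupCohomology (Rep.of s.ker.toRepresentation) (n + 1), δ n, cohomologyMap i (n + 1),
    cohomologyMap q (n + 1), δ' (n + 1), (hδ n).2.1, (hδ n).2.2, (hδ' (n + 1)).2.1,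
    (hδ' (n + 1)).2.2⟩

include d s in
lemma nsmul_eq_zero_of_fourTerm (hf : Function.Injective f) (hs : Function.Surjective s)
    (hfd : Function.Exact f d) (hds : Function.Exact d s) (n : ℕ)
    [Subsingleton (groupCohomology (Rep.of ρ₃) n)] (a : ℕ)
    (ha : ∀ x : groupCohomology (Rep.of ρ₂) (n + 1), a • x = 0)
    {y : groupCohomology (Rep.of ρ₀) (n + 2)} (hy : cohomologyMap f (n + 2) y = 0) :
    a • y = 0 := by
  obtain ⟨M, δ, i, q, δ', h₁, h₂, h₃, h₄⟩ := exists_connecting_fourTerm f d s hf hs hfd hds n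
  obtain ⟨m, rfl⟩ := (h₄ y).1 hy
  obtain ⟨x, hx⟩ := (h₂ (a • m)).1 (by rw [map_nsmul, ha])
  rw [← map_nsmul, ← hx, Subsingleton.elim x 0, map_zero, map_zero]

include f d s in
lemma exists_injective_of_fourTerm (hf : Function.Injective f) (hs : Function.Surjective s)
    (hfd : Function.Exact f d) (hds : Function.Exact d s) (n : ℕ)
    [Subsingleton (groupCohomology (Rep.of ρ₂) n)]
    [Subsingleton (groupCohomology (Rep.of ρ₁) (n + 1))] :
    ∃ φ : groupCohomology (Rep.of ρ₃) n →ₗ[k] groupCohomology (Rep.of ρ₀) (n + 2),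
      Function.Injective φ := by
  obtain ⟨M, δ, i, q, δ', h₁, h₂, h₃, h₄⟩ := exists_connecting_fourTerm f d s hf hs hfd hds n
  refine ⟨δ' ∘ₗ δ, (injective_iff_map_eq_zero _).2 fun x hx => ?_⟩
  obtain ⟨y, hy⟩ := (h₃ (δ x)).1 hx
  rw [Subsingleton.elim y 0, map_zero] at hy
  obtain ⟨z, rfl⟩ := (h₁ x).1 hy.symm
  rw [Subsingleton.elim z 0, map_zero]

end FourTerm

end LongExactSequence

/-- The embedding `a ↦ (a, ε a)` of `signRep p ε` into `swapRep p`. -/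
def signToSwap (p : ℕ) (ε : ℤˣ) : (signRep p ε).IntertwiningMap (swapRep p) :=
  ⟨LinearMap.id.prod ((ε : ℤ) • LinearMap.id), by
    rintro (i | i) <;> refine LinearMap.ext fun x => ?_ <;>
      simp [← mul_assoc, ← Units.val_mul]⟩

/-- The projection `(a, b) ↦ a + ε b` of `swapRep p` onto `signRep p ε`. -/
def swapToSign (p : ℕ) (ε : ℤˣ) : (swapRep p).IntertwiningMap (signRep p ε) :=
  ⟨LinearMap.id.coprod ((ε : ℤ) • LinearMap.id), by
    rintro (i | i) <;> refine LinearMap.ext fun x => ?_ <;>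
      simp [mul_add, ← mul_assoc, ← Units.val_mul, add_comm]⟩

/-- The embedding of `signRep p ε` into `funRep p ε` as constant functions. -/
def signToFun (p : ℕ) (ε : ℤˣ) : (signRep p ε).IntertwiningMap (funRep p ε) :=
  ⟨LinearMap.pi fun _ => LinearMap.id, by
    rintro (i | i) <;> refine LinearMap.ext fun x => funext fun j => ?_ <;> simp⟩

/-- The projection of `funRep p ε` onto `signRep p ε` by summing values. -/
def funToSign (p : ℕ) (ε : ℤˣ) [NeZero p] : (funRep p ε).IntertwiningMap (signRep p ε) :=
  ⟨∑ i, LinearMap.proj i, by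
    rintro (i | i) <;> refine LinearMap.ext fun x => ?_
    · simpa using Equiv.sum_comp (Equiv.addRight i) x
    · simpa [← Finset.mul_sum] using Equiv.sum_comp (Equiv.subLeft i) x⟩

/-- The difference map `f ↦ (i ↦ f (i + c) - f (i - c))`. -/
def funDiff (p : ℕ) (c : ZMod p) : (funRep p 1).IntertwiningMap (funRep p (-1)) :=
  ⟨LinearMap.funLeft ℤ ℤ (· + c) - LinearMap.funLeft ℤ ℤ (· - c), by
    rintro (i | i) <;> refine LinearMap.ext fun x => funext fun j => ?_
    · simp [LinearMap.funLeft, add_right_comm, add_sub_right_comm]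
    · simp [LinearMap.funLeft, sub_add_eq_sub_sub, sub_sub_eq_add_sub, add_sub_right_comm]⟩

@[simp] lemma signToSwap_apply (x : ℤ) : signToSwap p ε x = (x, ε * x) := rfl
@[simp] lemma swapToSign_apply (x : ℤ × ℤ) : swapToSign p ε x = x.1 + ε * x.2 := rfl
@[simp] lemma signToFun_apply (x : ℤ) (i : ZMod p) : signToFun p ε x i = x := rfl
@[simp] lemma funToSign_apply [NeZero p] (f : ZMod p → ℤ) : funToSign p ε f = ∑ i, f i :=
  (LinearMap.sum_apply _ _ f)
@[simp] lemma funDiff_apply (c : ZMod p) (f : ZMod p → ℤ) (i : ZMod p) :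
    funDiff p c f i = f (i + c) - f (i - c) := rfl

lemma signToSwap_injective : Function.Injective (signToSwap p ε) := fun _ _ h => congr_arg Prod.fst h

lemma swapToSign_surjective : Function.Surjective (swapToSign p ε) := fun x => ⟨(x, 0), by simp⟩

lemma exact_signToSwap_swapToSign {ε' : ℤˣ} (h : ε' = -ε) :
    Function.Exact (signToSwap p ε) (swapToSign p ε') := by
  subst h
  rintro ⟨a, b⟩
  simp only [swapToSign_apply, Set.mem_range, signToSwap_apply, Prod.mk.injEq]
  rcases Int.units_eq_one_or ε with rfl | rfl <;> simp <;> omega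

lemma signToFun_injective [NeZero p] : Function.Injective (signToFun p ε) :=
  fun _ _ h => congr_fun h 0

lemma funToSign_surjective [NeZero p] : Function.Surjective (funToSign p ε) :=
  fun x => ⟨Pi.single 0 x, by simp⟩

lemma exact_signToFun_funDiff [NeZero p] {c : ZMod p} (hc : c + c = 1) :
    Function.Exact (signToFun p 1) (funDiff p c) := by
  intro f
  constructor
  · intro hf
    have h1 (i : ZMod p) : f (i + 1) = f i := by
      have := congr_fun hf (i + c)
      rw [funDiff_apply, add_assoc, hc, add_sub_cancel_right] at this
      exact sub_eq_zero.1 this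
    have h2 (n : ℕ) : f n = f 0 := by
      induction n with
      | zero => simp
      | succ n ih => rw [Nat.cast_succ, h1, ih]
    exact ⟨f 0, funext fun i => by rw [signToFun_apply, ← h2 i.val, ZMod.natCast_zmod_val]⟩
  · rintro ⟨x, rfl⟩
    ext i
    simp

lemma exact_funDiff_funToSign [NeZero p] {c : ZMod p} (hc : c + c = 1) :
    Function.Exact (funDiff p c) (funToSign p (-1)) := by
  intro g
  constructor
  · intro hg
    rw [funToSign_apply] at hg
    let F (n : ℕ) : ℤ := ∑ j ∈ Finset.range n, g (j + c)
    have hF : F p = 0 := by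
      rw [← hg, ← Equiv.sum_comp (Equiv.addRight c) g]
      obtain _ | p := p
      · exact absurd rfl (NeZero.ne 0)
      · simp only [F]
        rw [Finset.sum_range fun j : ℕ => g (j + c)]
        exact Fintype.sum_congr _ _ fun j => congr_arg (fun i => g (i + c))
          (ZMod.natCast_zmod_val (n := p + 1) j)
    have hs (i : ZMod p) : F (i + 1).val = F (i.val + 1) := by
      have h1 : i + 1 = ((i.val + 1 : ℕ) : ZMod p) := by simp
      rw [h1, ZMod.val_natCast]
      obtain h | h : i.val + 1 < p ∨ i.val + 1 = p := (Nat.succ_le_of_lt i.val_lt).lt_or_eq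
      · rw [Nat.mod_eq_of_lt h]
      · rw [h, Nat.mod_self, hF]
        rfl
    refine ⟨fun i => F i.val, funext fun i => ?_⟩
    have h : i + c = (i - c) + 1 := by rw [← hc]; ring
    rw [funDiff_apply, h, hs]
    simp only [F, Finset.sum_range_succ]
    simp
  · rintro ⟨f, rfl⟩
    simp only [funToSign_apply, funDiff_apply, Finset.sum_sub_distrib]
    exact sub_eq_zero.2 ((Equiv.sum_comp (Equiv.addRight c) f).trans
      (Equiv.sum_comp (Equiv.subRight c) f).symm)

lemma eq_zero_of_nsmul_of_coprime {M : Type*} [AddCommGroup M] {a b : ℕ} (hab : a.Coprime b) {x : M}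
    (ha : a • x = 0) (hb : b • x = 0) : x = 0 :=
  AddMonoid.addOrderOf_eq_one_iff.1 <| Nat.eq_one_of_dvd_coprimes hab
    (addOrderOf_dvd_of_nsmul_eq_zero ha) (addOrderOf_dvd_of_nsmul_eq_zero hb)

lemma nsmul_eq_zero_of_equiv_zmod {M : Type*} [AddCommGroup M] [Module ℤ M] {q : ℕ}
    (h : Nonempty (M ≃ₗ[ℤ] ZMod q)) (x : M) : q • x = 0 := by
  obtain ⟨e⟩ := h
  refine e.injective ?_
  rw [map_nsmul, map_zero, nsmul_eq_mul, CharP.cast_eq_zero, zero_mul]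

lemma nonempty_equiv_zmod_of_injective {M N : Type*} [AddCommGroup M] [Module ℤ M] [AddCommGroup N]
    [Module ℤ N] [Nontrivial M] {q : ℕ} (hq : q.Prime) (h : Nonempty (N ≃ₗ[ℤ] ZMod q))
    (f : M →ₗ[ℤ] N) (hf : Function.Injective f) : Nonempty (M ≃ₗ[ℤ] ZMod q) := by
  have := Fact.mk hq
  obtain ⟨e⟩ := h
  have hi : Function.Injective (e.toLinearMap ∘ₗ f) := e.injective.comp hf
  refine ⟨LinearEquiv.ofBijective (e.toLinearMap ∘ₗ f) ⟨hi, fun y => ?_⟩⟩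
  obtain ⟨x, hx⟩ := exists_ne (0 : M)
  have hx' := (map_ne_zero_iff _ hi).2 hx
  refine ⟨(y / (e.toLinearMap ∘ₗ f) x).val • x, ?_⟩
  rw [map_nsmul, nsmul_eq_mul, ZMod.natCast_zmod_val, div_mul_cancel₀ _ hx']

lemma exists_add_self_eq_one (hp : Odd p) : ∃ c : ZMod p, c + c = 1 := by
  obtain ⟨m, hm⟩ := hp
  refine ⟨(m + 1 : ℕ), ?_⟩
  rw [← Nat.cast_add, show m + 1 + (m + 1) = p + 1 by omega, Nat.cast_succ, CharP.cast_eq_zero,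
    zero_add]

lemma nontrivial_signRep_one (p : ℕ) :
    Nontrivial (groupCohomology (Rep.of (signRep p (-1))) 1) := by
  by_contra! h
  obtain ⟨δ, hδ⟩ := exists_connecting (signToSwap p (-1)) (swapToSign p 1) signToSwap_injective
    swapToSign_surjective (exact_signToSwap_swapToSign (neg_neg 1).symm)
  obtain ⟨⟨a, b⟩, hx, hab⟩ := exists_invariants_lift (swapToSign p 1)
    (fun y => ((hδ 0).2.1 y).1 (Subsingleton.elim _ _)) 1 (by rintro (i | i) <;> simp)
  have h1 := congr_arg Prod.fst (hx (.sr 0))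
  simp only [swapToSign_apply, swapRep_sr, Prod.fst_swap, Units.val_one] at h1 hab
  omega

lemma subsingleton_signRep_zero : Subsingleton (groupCohomology (Rep.of (signRep p (-1))) 0) :=
  subsingleton_zero fun y hy => by
    have := hy (.sr 0)
    simp only [signRep_sr, Units.val_neg, Units.val_one] at this
    omega

section Deductions

variable [NeZero p] {n : ℕ}

lemma two_nsmul_eq_zero (hn : Odd n) (x : groupCohomology (Rep.of (signRep p ε)) n) :
    2 • x = 0 := by
  have := subsingleton_swapRep (p := p) hn
  rw [← cohomologyMap_comp_eq_nsmul (signToSwap p ε) (swapToSign p ε) 2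
    (fun x => by simp [← mul_assoc, ← Units.val_mul, two_mul]) n x,
    Subsingleton.elim (cohomologyMap _ n x) 0, map_zero]

lemma funToSign_signToFun (n : ℕ) (x : groupCohomology (Rep.of (signRep p ε)) n) :
    cohomologyMap (funToSign p ε) n (cohomologyMap (signToFun p ε) n x) = p • x :=
  cohomologyMap_comp_eq_nsmul _ _ p (fun x => by simp) n x

lemma subsingleton_signRep_one (hp : Odd p) (hn : Odd n) :
    Subsingleton (groupCohomology (Rep.of (signRep p 1)) n) := by
  have := subsingleton_funRep_one (p := p) hn
  refine subsingleton_of_forall_eq 0 fun x =>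
    eq_zero_of_nsmul_of_coprime (Nat.coprime_two_left.2 hp) (two_nsmul_eq_zero hn x) ?_
  rw [← funToSign_signToFun, Subsingleton.elim (cohomologyMap _ n x) 0, map_zero]

lemma nontrivial_signRep_odd_succ_succ (hp : Odd p) (hn : Odd n)
    [Nontrivial (groupCohomology (Rep.of (signRep p (-1))) n)] :
    Nontrivial (groupCohomology (Rep.of (signRep p (-1))) (n + 2)) := by
  obtain ⟨δ, hδ⟩ := exists_connecting (signToSwap p 1) (swapToSign p (-1)) signToSwap_injective
    swapToSign_surjective (exact_signToSwap_swapToSign rfl)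
  obtain ⟨δ', hδ'⟩ := exists_connecting (signToSwap p (-1)) (swapToSign p 1) signToSwap_injective
    swapToSign_surjective (exact_signToSwap_swapToSign (neg_neg 1).symm)
  obtain ⟨x, hx⟩ := exists_ne (0 : groupCohomology (Rep.of (signRep p (-1))) n)
  refine ⟨δ' (n + 1) (δ n x), 0, fun h => hx ?_⟩
  obtain ⟨y, hy⟩ := ((hδ' (n + 1)).2.1 _).1 h
  have h₁ : δ n x = 0 := eq_zero_of_nsmul_of_coprime (Nat.coprime_two_left.2 hp)
    (by rw [← map_nsmul, two_nsmul_eq_zero hn, map_zero])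
    (by rw [← hy, ← map_nsmul, nsmul_eq_zero_of_equiv_zmod
      (nonempty_swapRep_equiv_zmod hn.add_one n.succ_ne_zero), map_zero])
  obtain ⟨z, rfl⟩ := ((hδ n).2.1 x).1 h₁
  have := subsingleton_swapRep (p := p) hn
  rw [Subsingleton.elim z 0, map_zero]

lemma nontrivial_signRep_odd (hp : Odd p) (hn : Odd n) :
    Nontrivial (groupCohomology (Rep.of (signRep p (-1))) n) := by
  obtain ⟨m, rfl⟩ := hn
  induction m with
  | zero => exact nontrivial_signRep_one p
  | succ m ih => exact nontrivial_signRep_odd_succ_succ hp ⟨m, rfl⟩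

lemma nonempty_signRep_odd_equiv_zmod (hp : Odd p) (hn : Odd n) :
    Nonempty (groupCohomology (Rep.of (signRep p (-1))) n ≃ₗ[ℤ] ZMod 2) := by
  have := nontrivial_signRep_odd hp hn
  refine nonempty_equiv_zmod_of_injective Nat.prime_two (nonempty_funRep_neg_one_equiv_zmod hn)
    (cohomologyMap (signToFun p (-1)) n) ((injective_iff_map_eq_zero _).2 fun x hx => ?_)
  exact eq_zero_of_nsmul_of_coprime (Nat.coprime_two_left.2 hp) (two_nsmul_eq_zero hn x)
    (by rw [← funToSign_signToFun, hx, map_zero])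

lemma injective_signToSwap (hp : Odd p) (hn : Even n) (hn0 : n ≠ 0) :
    Function.Injective (cohomologyMap (signToSwap p (-1)) n) := by
  obtain ⟨m, rfl⟩ := Nat.exists_eq_succ_of_ne_zero hn0
  obtain ⟨δ, hδ⟩ := exists_connecting (signToSwap p (-1)) (swapToSign p 1) signToSwap_injective
    swapToSign_surjective (exact_signToSwap_swapToSign (neg_neg 1).symm)
  refine (injective_iff_map_eq_zero _).2 fun x hx => ?_
  obtain ⟨y, rfl⟩ := ((hδ m).2.2 x).1 hx
  have := subsingleton_signRep_one hp (Nat.even_add_one.1 hn |> Nat.not_even_iff_odd.1)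
  rw [Subsingleton.elim y 0, map_zero]

lemma nonempty_signRep_even_equiv_zmod (hp : p.Prime) (hp' : Odd p) (hn : Even n) (hn0 : n ≠ 0)
    [Nontrivial (groupCohomology (Rep.of (signRep p (-1))) n)] :
    Nonempty (groupCohomology (Rep.of (signRep p (-1))) n ≃ₗ[ℤ] ZMod p) :=
  nonempty_equiv_zmod_of_injective hp (nonempty_swapRep_equiv_zmod hn hn0) _
    (injective_signToSwap hp' hn hn0)

lemma nontrivial_signRep_even_succ_succ (hp : p.Prime) (hp' : Odd p) (hn : Even n)
    [Subsingleton (groupCohomology (Rep.of (signRep p (-1))) n)] :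
    Nontrivial (groupCohomology (Rep.of (signRep p (-1))) (n + 2)) := by
  by_contra! h
  have := Fact.mk hp
  obtain ⟨c, hc⟩ := exists_add_self_eq_one hp'
  obtain ⟨δ, hδ⟩ := exists_connecting (signToSwap p 1) (swapToSign p (-1)) signToSwap_injective
    swapToSign_surjective (exact_signToSwap_swapToSign rfl)
  have hn2 : Even (n + 2) := hn.add even_two
  have h2 (y : groupCohomology (Rep.of (signRep p 1)) (n + 2)) : 2 • 2 • y = 0 :=
    nsmul_eq_zero_of_fourTerm (signToFun p 1) (funDiff p c) (funToSign p (-1)) signToFun_injective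
      funToSign_surjective (exact_signToFun_funDiff hc) (exact_funDiff_funToSign hc) n 2
      (nsmul_eq_zero_of_equiv_zmod (nonempty_funRep_neg_one_equiv_zmod hn.add_one))
      (by rw [map_nsmul, nsmul_eq_zero_of_equiv_zmod
        (nonempty_funRep_one_equiv_zmod hn2 (by omega))])
  have he := nonempty_swapRep_equiv_zmod (p := p) hn2 (by omega)
  have : Nontrivial (groupCohomology (Rep.of (swapRep p)) (n + 2)) := he.some.toEquiv.nontrivial
  obtain ⟨x, hx⟩ := exists_ne (0 : groupCohomology (Rep.of (swapRep p)) (n + 2))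
  obtain ⟨y, rfl⟩ := ((hδ (n + 2)).1 x).1 (Subsingleton.elim _ _)
  have hcop := Nat.coprime_two_left.2 hp'
  refine hx (eq_zero_of_nsmul_of_coprime hcop (eq_zero_of_nsmul_of_coprime hcop ?_ ?_)
    (nsmul_eq_zero_of_equiv_zmod he _))
  · rw [← map_nsmul, ← map_nsmul, h2, map_zero]
  · exact nsmul_eq_zero_of_equiv_zmod he _

lemma subsingleton_signRep_even_succ_succ (hp : p.Prime) (hp' : Odd p) (hn : Even n) (hn0 : n ≠ 0)
    [Nontrivial (groupCohomology (Rep.of (signRep p (-1))) n)] :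
    Subsingleton (groupCohomology (Rep.of (signRep p (-1))) (n + 2)) := by
  by_contra! h
  obtain ⟨c, hc⟩ := exists_add_self_eq_one hp'
  obtain ⟨δ, hδ⟩ := exists_connecting (signToSwap p 1) (swapToSign p (-1)) signToSwap_injective
    swapToSign_surjective (exact_signToSwap_swapToSign rfl)
  have hn2 : Even (n + 2) := hn.add even_two
  have := subsingleton_funRep_neg_one (p := p) hn hn0
  have := subsingleton_funRep_one (p := p) hn.add_one
  obtain ⟨φ, hφ⟩ := exists_injective_of_fourTerm (signToFun p 1) (funDiff p c) (funToSign p (-1))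
    signToFun_injective funToSign_surjective (exact_signToFun_funDiff hc)
    (exact_funDiff_funToSign hc) n
  obtain ⟨x, hx⟩ := exists_ne (0 : groupCohomology (Rep.of (signRep p (-1))) n)
  have := subsingleton_signRep_one (p := p) hp' hn2.add_one
  obtain ⟨e₁⟩ := nonempty_swapRep_equiv_zmod (p := p) hn2 (by omega)
  obtain ⟨e₂⟩ := nonempty_signRep_even_equiv_zmod hp hp' hn2 (by omega)
  have hinj : Function.Injective (cohomologyMap (swapToSign p (-1)) (n + 2)) := by
    have := Finite.of_equiv _ e₁.toEquiv.symm
    refine (Function.Surjective.injective_of_finite (e₁.toEquiv.trans e₂.toEquiv.symm)) fun y => ?_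
    exact ((hδ (n + 2)).2.1 y).1 (Subsingleton.elim _ _)
  obtain ⟨z, hz⟩ := ((hδ (n + 1)).2.2 (φ x)).1
    (hinj (((hδ (n + 2)).1.apply_apply_eq_zero _).trans (map_zero _).symm))
  refine hx (hφ (.trans (eq_zero_of_nsmul_of_coprime (Nat.coprime_two_left.2 hp') ?_ ?_)
    (map_zero φ).symm))
  · rw [← hz, ← map_nsmul, two_nsmul_eq_zero hn.add_one, map_zero]
  · rw [← map_nsmul, nsmul_eq_zero_of_equiv_zmod
      (nonempty_signRep_even_equiv_zmod hp hp' hn hn0), map_zero]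

lemma signRep_even (hp : p.Prime) (hp' : Odd p) (k : ℕ) :
    Subsingleton (groupCohomology (Rep.of (signRep p (-1))) (4 * k)) ∧
      Nontrivial (groupCohomology (Rep.of (signRep p (-1))) (4 * k + 2)) := by
  have h (k : ℕ) (_ : Subsingleton (groupCohomology (Rep.of (signRep p (-1))) (4 * k))) :
      Nontrivial (groupCohomology (Rep.of (signRep p (-1))) (4 * k + 2)) :=
    nontrivial_signRep_even_succ_succ hp hp' ⟨2 * k, by omega⟩
  induction k with
  | zero => exact ⟨subsingleton_signRep_zero, h 0 subsingleton_signRep_zero⟩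
  | succ k ih =>
    have := ih.2
    have h0 := subsingleton_signRep_even_succ_succ hp hp' (n := 4 * k + 2) ⟨2 * k + 1, by omega⟩
      (by omega)
    exact ⟨h0, h (k + 1) h0⟩

end Deductions

end DihedralSign

/-- The group cohomology of `D_{2p}` (`p` an odd prime) with coefficients in the
sign representation `ℤ₋` in positive degrees is 4-periodic with pattern
`0, ℤ/2, ℤ/p, ℤ/2`. -/
theorem groupCohomology_dihedral_sign_int (p : ℕ) (hp : p.Prime) (hodd : Odd p)
    (n : ℕ) (hn : 1 ≤ n) :
    (n % 2 = 1 →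
      Nonempty ((groupCohomology (zminus p) n) ≃ₗ[ℤ] ZMod 2)) ∧
    (n % 4 = 2 →
      Nonempty ((groupCohomology (zminus p) n) ≃ₗ[ℤ] ZMod p)) ∧
    (n % 4 = 0 →
      Subsingleton (groupCohomology (zminus p) n)) := by
  have : NeZero p := ⟨hp.ne_zero⟩
  rw [zminus, ← DihedralSign.signRep_neg_one]
  refine ⟨fun h => DihedralSign.nonempty_signRep_odd_equiv_zmod hodd (Nat.odd_iff.2 h),
    fun h => ?_, fun h => ?_⟩
  · have := (DihedralSign.signRep_even hp hodd (n / 4)).2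
    rw [show 4 * (n / 4) + 2 = n by omega] at this
    exact DihedralSign.nonempty_signRep_even_equiv_zmod hp hodd (Nat.even_iff.2 (by omega))
      (by omega)
  · have := (DihedralSign.signRep_even hp hodd (n / 4)).1
    rwa [show 4 * (n / 4) = n by omega] at this
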